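/- arXiv:2410.03623 — 2 statements merged into one kernel-verified Lean document; each statement's English description precedes it below -/
import Mathlib

section
/- For n ≤ -2, the scalar harmonic function U_{n,-n-1}^{±} (viewed as the 𝒜-valued function U_{n,-n-1}^{±} + 0e₁ + 0e₂) is contragenic on B^e = {|x| > 1}: it is orthogonal in L²(B^e) to every basic monogenic X_{n',m'}^{±} and every basic antimonogenic X̄_{n',m'}^{±}. -/
open MeasureTheory Real

noncomputable section

/-- Euclidean space `ℝ³` with coordinates `x 0, x 1, x 2`. -/
abbrev E3 := EuclideanSpace ℝ (Fin 3)

/-- Legendre polynomial of degree `n` via Rodrigues' formula. -/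
def legendreP (n : ℕ) (t : ℝ) : ℝ :=
  (1 / (2 ^ n * n.factorial : ℝ)) * iteratedDeriv n (fun s : ℝ => (s ^ 2 - 1) ^ n) t

/-- Associated Legendre function of nonnegative integer degree `n` and order `m`
(Ferrers-type definition, no Condon–Shortley phase):
`P_n^m(t) = (1-t²)^{m/2} (d/dt)^m P_n(t)`. -/
def assocLegendreNat (n m : ℕ) (t : ℝ) : ℝ :=
  (1 - t ^ 2) ^ ((m : ℝ) / 2) * iteratedDeriv m (legendreP n) t

/-- Associated Legendre function of arbitrary integer degree, using the
reflection `P_{-n}^m = P_{n-1}^m` for negative degrees. -/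
def assocLegendre (n : ℤ) (m : ℕ) (t : ℝ) : ℝ :=
  if 0 ≤ n then assocLegendreNat n.toNat m t else assocLegendreNat (-n - 1).toNat m t

/-- Spherical radius `ρ`. -/
def sphRho (x : E3) : ℝ := Real.sqrt (x 0 ^ 2 + x 1 ^ 2 + x 2 ^ 2)

/-- Azimuthal angle `φ` of the point `(x₁, x₂)`. -/
def sphPhi (x : E3) : ℝ := Complex.arg ⟨x 1, x 2⟩

/-- Azimuthal factor `Φ_m^±(φ)`; `sgn = true` corresponds to `+` (cosine),
`sgn = false` to `−` (sine). -/
def PhiFac (m : ℕ) (sgn : Bool) (φ : ℝ) : ℝ :=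
  if sgn then Real.cos (m * φ) else Real.sin (m * φ)

/-- Solid spherical harmonic `U_{n,m}^{±}(x) = ρ^n P_n^m(cos θ) Φ_m^{±}(φ)`. -/
def solidU (n : ℤ) (m : ℕ) (sgn : Bool) (x : E3) : ℝ :=
  sphRho x ^ n * assocLegendre n m (x 0 / sphRho x) * PhiFac m sgn (sphPhi x)

/-- The exterior `B^e` of the closed unit ball in `ℝ³`. -/
def extB : Set E3 := {x : E3 | 1 < ‖x‖}

/-- The quaternions; the subspace `𝒜 = ℝ + ℝe₁ + ℝe₂` consists of those
quaternions with `imK = 0`. -/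
abbrev H := Quaternion ℝ

def qe1 : H := ⟨0, 1, 0, 0⟩
def qe2 : H := ⟨0, 0, 1, 0⟩

/-- Partial derivative `∂/∂xᵢ` of a quaternion-valued function. -/
def pd (i : Fin 3) (f : E3 → H) (x : E3) : H :=
  fderiv ℝ f x (EuclideanSpace.single i 1)

/-- The Cauchy–Riemann (Fueter) operator `∂̄ = ∂/∂x₀ + e₁∂/∂x₁ + e₂∂/∂x₂`. -/
def Dbar (f : E3 → H) (x : E3) : H := pd 0 f x + qe1 * pd 1 f x + qe2 * pd 2 f x

/-- The conjugate Fueter operator `∂ = ∂/∂x₀ − e₁∂/∂x₁ − e₂∂/∂x₂`. -/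
def Dop (f : E3 → H) (x : E3) : H := pd 0 f x - qe1 * pd 1 f x - qe2 * pd 2 f x

/-- The solid harmonic `U_{n,m}^±` regarded as a quaternion-valued function. -/
def solidUq (n : ℤ) (m : ℕ) (sgn : Bool) (x : E3) : H := ((solidU n m sgn x : ℝ) : H)

/-- The basic spherical monogenic `X_{n,m}^{±} = ∂U_{n+1,m}^{±}`. -/
def Xmon (n : ℤ) (m : ℕ) (sgn : Bool) : E3 → H := Dop (solidUq (n + 1) m sgn)

/-- The scalar inner product on `𝒜`-valued quaternions:
`⟨p,q⟩ = p₀q₀ + p₁q₁ + p₂q₂`. -/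
def qip (p q : H) : ℝ := p.re * q.re + p.imI * q.imI + p.imJ * q.imJ

lemma polar_mp : MeasurePreserving (fun p : ℝ × ℝ => (p.1 * cos p.2, p.1 * sin p.2))
    (((volume.restrict (Set.Ioi (0:ℝ))).withDensity (fun r => ENNReal.ofReal r)).prod
      (volume.restrict (Set.Ioo (-π) π))) volume := by
  have hm : Measurable (fun p : ℝ × ℝ => (p.1 * cos p.2, p.1 * sin p.2)) := by fun_prop
  refine ⟨hm, ?_⟩
  ext s hs
  rw [Measure.map_apply hm hs, prod_withDensity_left (by fun_prop), Measure.prod_restrict,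
    withDensity_apply _ (hm hs), ← lintegral_indicator_one hs, ← lintegral_comp_polarCoord_symm,
    ← lintegral_indicator (hm hs)]
  refine lintegral_congr fun p => ?_
  simp only [polarCoord_symm_apply]
  by_cases h : (p.1 * cos p.2, p.1 * sin p.2) ∈ s
  · simp [h]
  · simp [h]

/-- Separation of variables in spherical coordinates. -/
lemma sph_zero (F : ℝ × (ℝ × ℝ) → ℝ) (R T P : ℝ → ℝ)
    (h : ∀ ρ θ φ, 0 < ρ → θ ∈ Set.Ioo 0 π → φ ∈ Set.Ioo (-π) π →
      F (ρ * cos θ, ρ * sin θ * cos φ, ρ * sin θ * sin φ) = R ρ * T θ * P φ)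
    (h0 : (∫ θ in Set.Ioo 0 π, sin θ * T θ) = 0 ∨ (∫ φ in Set.Ioo (-π) π, P φ) = 0) :
    ∫ x, F x = 0 := by
  by_cases hF : Integrable F
  swap
  · exact integral_undef hF
  set μr := (volume.restrict (Set.Ioi (0:ℝ))).withDensity (fun r => ENNReal.ofReal r) with hμr
  set μφ := (volume.restrict (Set.Ioo (-π) π)) with hμφ
  have hmp := (MeasurePreserving.id (volume : Measure ℝ)).prod polar_mp
  have hmp2 : MeasurePreserving (MeasurableEquiv.prodAssoc : (ℝ × ℝ) × ℝ ≃ᵐ ℝ × ℝ × ℝ)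
    (((volume : Measure ℝ).prod μr).prod μφ) (volume.prod (μr.prod μφ)) :=
    ⟨MeasurableEquiv.measurable _, Measure.prodAssoc_prod⟩
  have hmp3 := hmp.comp hmp2
  have e1 : ∫ x, F x = ∫ x, F x ∂((volume : Measure ℝ).prod (volume : Measure (ℝ × ℝ))) := rfl
  have hF' : Integrable F ((volume : Measure ℝ).prod (volume : Measure (ℝ × ℝ))) := hF
  rw [e1, ← hmp3.map_eq, integral_map hmp3.measurable.aemeasurable
    (by rw [hmp3.map_eq]; exact hF'.aestronglyMeasurable)]
  set B : ℝ × ℝ → ℝ := fun p => R √(p.1 ^ 2 + p.2 ^ 2) *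
    T (Complex.arg (Complex.equivRealProd.symm p)) with hB
  have hμ : ((volume : Measure ℝ).prod μr).prod μφ =
      ((volume.restrict (Set.univ ×ˢ Set.Ioi (0:ℝ))).withDensity
        (fun p : ℝ × ℝ => ENNReal.ofReal p.2)).prod μφ := by
    rw [hμr, prod_withDensity_right (by fun_prop)]
    congr 2
    rw [Measure.volume_eq_prod, ← Measure.prod_restrict, Measure.restrict_univ]
  have hBT : ∀ ρ θ, 0 < ρ → θ ∈ Set.Ioo (-π) π → B (ρ * cos θ, ρ * sin θ) = R ρ * T θ := by
    intro ρ θ hρ hθ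
    have := polarCoord.right_inv (x := (ρ, θ)) ⟨hρ, hθ⟩
    rw [polarCoord_symm_apply, polarCoord_apply, Prod.mk.injEq] at this
    simp only [hB]
    rw [this.1, this.2]
  have hae : ∀ᵐ x ∂(((volume : Measure ℝ).prod μr).prod μφ),
      F ((Prod.map id (fun p : ℝ × ℝ => (p.1 * cos p.2, p.1 * sin p.2)) ∘
        (MeasurableEquiv.prodAssoc : (ℝ × ℝ) × ℝ ≃ᵐ ℝ × ℝ × ℝ)) x) = B x.1 * P x.2 := by
    have hac : (((volume : Measure ℝ).prod μr).prod μφ) ≪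
        volume.restrict ((Set.univ ×ˢ Set.Ioi (0:ℝ)) ×ˢ (Set.Ioo (-π) π)) := by
      rw [hμ, Measure.volume_eq_prod (ℝ × ℝ) ℝ, ← Measure.prod_restrict]
      exact (withDensity_absolutelyContinuous _ _).prod Measure.AbsolutelyContinuous.rfl
    apply hac.ae_le
    filter_upwards [ae_restrict_mem ((MeasurableSet.univ.prod measurableSet_Ioi).prod
      measurableSet_Ioo)] with x hx
    obtain ⟨⟨a, r⟩, φ⟩ := x
    obtain ⟨⟨-, hr⟩, hφ⟩ := hx
    simp only [Set.mem_Ioi] at hr hφ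
    have hsrc : (a, r) ∈ polarCoord.source := Or.inr hr.ne'
    have ht := polarCoord.map_source hsrc
    have hl := polarCoord.left_inv hsrc
    generalize polarCoord (a, r) = q at ht hl
    obtain ⟨ρ, θ⟩ := q
    rw [polarCoord_symm_apply, Prod.mk.injEq] at hl
    obtain ⟨hρ, hθ⟩ := ht
    simp only [Set.mem_Ioi] at hρ hθ hl
    obtain ⟨rfl, rfl⟩ := hl
    have hs : 0 < sin θ := pos_of_mul_pos_right hr hρ.le
    have hθ0 : 0 < θ := by
      by_contra hc
      exact absurd (sin_nonpos_of_nonpos_of_neg_pi_le (not_lt.1 hc) hθ.1.le) (not_le.2 hs)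
    have := h ρ θ φ hρ ⟨hθ0, hθ.2⟩ hφ
    rw [hBT ρ θ hρ hθ, ← this]
    rfl
  rw [integral_congr_ae hae, integral_prod_mul]
  rcases h0 with h0 | h0
  swap
  · rw [h0, mul_zero]
  rw [mul_eq_zero]; left
  rw [hμr, prod_withDensity_right (by fun_prop),
    integral_withDensity_eq_integral_toReal_smul (by fun_prop) (by simp)]
  have : (volume : Measure ℝ).prod (volume.restrict (Set.Ioi (0:ℝ))) =
      volume.restrict (Set.univ ×ˢ Set.Ioi (0:ℝ)) := by
    rw [Measure.volume_eq_prod, ← Measure.prod_restrict, Measure.restrict_univ]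
  rw [this, ← integral_indicator (MeasurableSet.univ.prod measurableSet_Ioi),
    ← integral_comp_polarCoord_symm]
  have : ∫ p in polarCoord.target, p.1 • ((Set.univ ×ˢ Set.Ioi (0:ℝ)).indicator
      (fun x : ℝ × ℝ => (ENNReal.ofReal x.2).toReal • B x) (polarCoord.symm p)) =
      ∫ p in polarCoord.target, (p.1 ^ 2 * R p.1) *
        ((Set.Ioo 0 π).indicator (fun θ => sin θ * T θ) p.2) := by
    refine setIntegral_congr_fun polarCoord.open_target.measurableSet ?_
    rintro ⟨ρ, θ⟩ ⟨hρ, hθ⟩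
    simp only [Set.mem_Ioi] at hρ hθ
    simp only [polarCoord_symm_apply]
    by_cases h1 : θ ∈ Set.Ioo 0 π
    · have hs := sin_pos_of_mem_Ioo h1
      have hps : 0 < ρ * sin θ := by positivity
      rw [Set.indicator_of_mem (by simpa using hps), Set.indicator_of_mem h1, hBT ρ θ hρ hθ,
        ENNReal.toReal_ofReal hps.le]
      simp only [smul_eq_mul]; ring
    · have hθ0 : θ ≤ 0 := by
        by_contra hc
        exact h1 ⟨not_le.1 hc, hθ.2⟩
      have hs : sin θ ≤ 0 := sin_nonpos_of_nonpos_of_neg_pi_le hθ0 hθ.1.le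
      have hps : ρ * sin θ ≤ 0 := mul_nonpos_of_nonneg_of_nonpos hρ.le hs
      rw [Set.indicator_of_notMem (by simpa using hps), Set.indicator_of_notMem h1]
      simp
  rw [this]
  have : volume.restrict polarCoord.target =
      (volume.restrict (Set.Ioi (0:ℝ))).prod (volume.restrict (Set.Ioo (-π) π)) := by
    rw [polarCoord_target, Measure.volume_eq_prod, Measure.prod_restrict]
  rw [this, integral_prod_mul (fun ρ => ρ ^ 2 * R ρ)
    ((Set.Ioo 0 π).indicator (fun θ => sin θ * T θ)), mul_eq_zero]
  right
  rw [integral_indicator measurableSet_Ioo, Measure.restrict_restrict measurableSet_Ioo,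
    Set.inter_eq_left.2, h0]
  exact Set.Ioo_subset_Ioo_left (by linarith [pi_pos])

lemma e3_integral (F : EuclideanSpace ℝ (Fin 3) → ℝ) :
    ∫ x, F x = ∫ p : ℝ × (ℝ × ℝ), F (!₂[p.1, p.2.1, p.2.2]) := by
  rw [← (PiLp.volume_preserving_toLp (Fin 3)).integral_comp
    (MeasurableEquiv.toLp 2 (Fin 3 → ℝ)).measurableEmbedding]
  have h1 := (volume_preserving_piFinSuccAbove (fun _ : Fin 3 => ℝ) 0).symm
  rw [← h1.integral_comp' ]
  have h2 := (MeasurePreserving.id (volume : Measure ℝ)).prod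
    (volume_preserving_finTwoArrow ℝ).symm
  have e : MeasurableEmbedding (Prod.map (id : ℝ → ℝ) (MeasurableEquiv.finTwoArrow (α := ℝ)).symm) :=
    MeasurableEmbedding.id.prodMap (MeasurableEquiv.measurableEmbedding _)
  have := h2.integral_comp e (fun p => F (WithLp.toLp 2
    ((MeasurableEquiv.piFinSuccAbove (fun _ : Fin 3 => ℝ) 0).symm p)))
  refine Eq.trans this.symm ?_
  refine integral_congr_ae (Filter.Eventually.of_forall fun p => ?_)
  simp only
  congr 2
  ext i
  fin_cases i <;> rfl

open Polynomial in
lemma iteratedDeriv_poly (p : Polynomial ℝ) (j : ℕ) :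
    iteratedDeriv j (fun x => p.eval x) = fun x => (derivative^[j] p).eval x := by
  induction j with
  | zero => simp
  | succ j ih =>
    rw [iteratedDeriv_succ, ih, Function.iterate_succ_apply']
    funext x
    exact Polynomial.deriv _

open Polynomial in
/-- The polynomial `(X²-1)^k`. -/
def uPoly (k : ℕ) : Polynomial ℝ := (X ^ 2 - 1) ^ k

open Polynomial in
lemma legendre_iter (k m : ℕ) (t : ℝ) : iteratedDeriv m (legendreP k) t =
    (1 / (2 ^ k * k.factorial : ℝ)) * (derivative^[k + m] (uPoly k)).eval t := by
  have : legendreP k = fun t => ((C (1 / (2 ^ k * k.factorial : ℝ))) *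
      (derivative^[k] (uPoly k))).eval t := by
    funext t
    have := congrFun (iteratedDeriv_poly (uPoly k) k) t
    simp only [eval_mul, eval_C, legendreP]
    rw [← this]
    simp [uPoly]
  rw [this, iteratedDeriv_poly, Polynomial.iterate_derivative_C_mul, ← Function.iterate_add_apply,
    add_comm m k]
  simp only [eval_mul, eval_C]

open Polynomial in
lemma legendre_ode (k j : ℕ) : (X ^ 2 - 1) * derivative^[j + 2] (uPoly k) +
    C (2 * (j + 1 - k : ℝ)) * X * derivative^[j + 1] (uPoly k) +
    C ((j + 1) * (j - 2 * k : ℝ)) * derivative^[j] (uPoly k) = 0 := by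
  induction j with
  | zero =>
    have h0 : (X ^ 2 - 1) * derivative (uPoly k) = C (2 * k : ℝ) * X * uPoly k := by
      unfold uPoly
      cases k with
      | zero => simp
      | succ k => simp [derivative_pow]; ring
    have h1 := congrArg derivative h0
    simp only [derivative_mul, derivative_sub, derivative_X_pow, derivative_one, derivative_C,
      derivative_X] at h1
    simp only [Function.iterate_succ_apply', Function.iterate_zero, id]
    simp at h1 ⊢
    linear_combination h1
  | succ j ih =>
    have h1 := congrArg derivative ih
    simp only [Function.iterate_succ_apply', derivative_mul, derivative_add, derivative_sub,
      derivative_X_pow, derivative_one, derivative_C, derivative_X, derivative_zero] at h1 ⊢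
    have h2 : (C 2 : Polynomial ℝ) = 2 := rfl
    simp [h2] at h1 ⊢
    linear_combination h1

open Polynomial in
lemma top_const (m : ℕ) : ∃ c : ℝ, ∀ t, iteratedDeriv m (legendreP m) t = c := by
  have h : (derivative^[m + m] (uPoly m)).natDegree ≤ 0 := by
    refine (natDegree_iterate_derivative _ _).trans ?_
    have : (uPoly m).natDegree ≤ m * 2 := by
      unfold uPoly
      refine natDegree_pow_le_of_le m ?_
      compute_degree
    omega
  replace h := eq_C_of_natDegree_le_zero h
  refine ⟨(1 / (2 ^ m * m.factorial : ℝ)) * (derivative^[m + m] (uPoly m)).coeff 0,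
    fun t => ?_⟩
  rw [legendre_iter]
  nth_rewrite 1 [h]
  rw [eval_C]

/-- The polynomial factor of the associated Legendre function. -/
def qPoly (k m : ℕ) : Polynomial ℝ :=
  Polynomial.C (1 / (2 ^ k * k.factorial : ℝ)) * (Polynomial.derivative^[k + m] (uPoly k))

lemma legendre_q (k m : ℕ) (t : ℝ) : iteratedDeriv m (legendreP k) t = (qPoly k m).eval t := by
  rw [legendre_iter, qPoly, Polynomial.eval_mul, Polynomial.eval_C]

open Polynomial in
lemma q_ode (k m : ℕ) (t : ℝ) :
    (1 - t ^ 2) * (derivative (derivative (qPoly k m))).eval t =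
      2 * (m + 1) * t * (derivative (qPoly k m)).eval t
        + (k + m + 1) * (m - k) * (qPoly k m).eval t := by
  have h := congrArg (eval t) (legendre_ode k (k + m))
  simp only [Function.iterate_succ_apply', qPoly, derivative_C_mul, eval_mul, eval_C, eval_add,
    eval_sub, eval_pow, eval_X, eval_one, eval_zero] at h ⊢
  push_cast at h
  linear_combination (-(1 / (2 ^ k * k.factorial : ℝ))) * h

open Polynomial in
/-- the angular factor of `∂₀ U`. -/
def Yfun (k m : ℕ) (t : ℝ) : ℝ :=
  -(k + m + 1) * t * (qPoly k m).eval t + (1 - t ^ 2) * (derivative (qPoly k m)).eval t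

open Polynomial in
lemma theta_zero (k m : ℕ) (c : ℝ) :
    ∫ θ in Set.Ioo 0 π, sin θ * (c * sin θ ^ m * (sin θ ^ m * Yfun k m (cos θ))) = 0 := by
  set W : Polynomial ℝ := (1 - X ^ 2) ^ (m + 1) *
    (C (k + m + 1 : ℝ) * qPoly k m + X * derivative (qPoly k m)) with hW
  have hW' : ∀ t, (derivative W).eval t = (k + m + 2) * ((1 - t ^ 2) ^ m * Yfun k m t) := by
    intro t
    have ho := q_ode k m t
    simp only [hW, derivative_mul, derivative_pow, derivative_add, derivative_sub, derivative_one,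
      derivative_X, derivative_C, eval_mul, eval_add, eval_sub, eval_pow, eval_one, eval_X, eval_C,
      eval_zero, Yfun]
    simp
    linear_combination (1 - t ^ 2) ^ m * t * ho
  have hd : ∀ θ ∈ Set.uIcc 0 π, HasDerivAt (fun θ => -(c / (k + m + 2)) * W.eval (cos θ))
      (sin θ * (c * sin θ ^ m * (sin θ ^ m * Yfun k m (cos θ)))) θ := by
    intro θ _
    have := ((W.hasDerivAt (cos θ)).comp θ (hasDerivAt_cos θ)).const_mul (-(c / (k + m + 2)))
    refine this.congr_deriv ?_
    rw [hW', ← sin_sq]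
    have : (k + m + 2 : ℝ) ≠ 0 := by positivity
    field_simp
    ring
  rw [← integral_Ioc_eq_integral_Ioo, ← intervalIntegral.integral_of_le pi_pos.le,
    intervalIntegral.integral_eq_sub_of_hasDerivAt hd]
  · simp [hW]
  · apply Continuous.intervalIntegrable
    unfold Yfun
    fun_prop

lemma int_cos_zero (a : ℤ) (ha : a ≠ 0) : ∫ φ in (-π)..π, cos (a * φ) = 0 := by
  have : (a : ℝ) ≠ 0 := by exact_mod_cast ha
  rw [intervalIntegral.integral_comp_mul_left (fun x => cos x) this]
  simp [sin_int_mul_pi]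

lemma int_sin_zero (a : ℤ) : ∫ φ in (-π)..π, sin (a * φ) = 0 := by
  by_cases h : (a : ℝ) = 0
  · simp [h]
  rw [intervalIntegral.integral_comp_mul_left (fun x => sin x) h]
  simp

lemma phi_zero (m m' : ℕ) (s s' : Bool) (h : m ≠ m') :
    ∫ φ in Set.Ioo (-π) π, PhiFac m s φ * PhiFac m' s' φ = 0 := by
  rw [← integral_Ioc_eq_integral_Ioo, ← intervalIntegral.integral_of_le (by linarith [pi_pos])]
  have h1 : ((m : ℤ) - m') ≠ 0 := by omega
  have h2 : ((m : ℤ) + m') ≠ 0 := by omega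
  have c1 := int_cos_zero _ h1
  have c2 := int_cos_zero _ h2
  have s1 := int_sin_zero ((m : ℤ) - m')
  have s2 := int_sin_zero ((m : ℤ) + m')
  have i1 : ∀ a : ℤ, IntervalIntegrable (fun φ => cos (a * φ)) volume (-π) π := fun a =>
    Continuous.intervalIntegrable (by fun_prop) _ _
  have i2 : ∀ a : ℤ, IntervalIntegrable (fun φ => sin (a * φ)) volume (-π) π := fun a =>
    Continuous.intervalIntegrable (by fun_prop) _ _
  have key : ∀ φ : ℝ, PhiFac m s φ * PhiFac m' s' φ =
      (if s then (if s' then (1/2) * (cos (((m : ℤ) - m' : ℤ) * φ) + cos (((m : ℤ) + m' : ℤ) * φ))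
        else (1/2) * (sin (((m : ℤ) + m' : ℤ) * φ) - sin (((m : ℤ) - m' : ℤ) * φ)))
      else (if s' then (1/2) * (sin (((m : ℤ) + m' : ℤ) * φ) + sin (((m : ℤ) - m' : ℤ) * φ))
        else (1/2) * (cos (((m : ℤ) - m' : ℤ) * φ) - cos (((m : ℤ) + m' : ℤ) * φ)))) := by
    intro φ
    push_cast
    simp only [PhiFac, sub_mul, add_mul, cos_add, cos_sub, sin_add, sin_sub]
    cases s <;> cases s' <;> simp <;> ring
  simp_rw [key]
  cases s <;> cases s' <;> simp only [if_true, if_false, Bool.false_eq_true] <;>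
    rw [intervalIntegral.integral_const_mul]
  · rw [intervalIntegral.integral_sub (i1 _) (i1 _), c1, c2]; simp
  · rw [intervalIntegral.integral_add (i2 _) (i2 _), s1, s2]; simp
  · rw [intervalIntegral.integral_sub (i2 _) (i2 _), s1, s2]; simp
  · rw [intervalIntegral.integral_add (i1 _) (i1 _), c1, c2]; simp

lemma solidU_neg (k m : ℕ) (sgn : Bool) (x : E3) : solidU (-(k + 1 : ℤ)) m sgn x =
    sphRho x ^ (-(k + 1 : ℤ)) * ((1 - (x 0 / sphRho x) ^ 2) ^ ((m : ℝ) / 2) *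
      (qPoly k m).eval (x 0 / sphRho x)) * PhiFac m sgn (sphPhi x) := by
  unfold solidU assocLegendre
  rw [if_neg (by omega), assocLegendreNat, legendre_q]
  congr 5
  all_goals omega

lemma one_sub_pos (a b c : ℝ) (h : 0 < b ^ 2 + c ^ 2) :
    0 < 1 - (a / √(a ^ 2 + b ^ 2 + c ^ 2)) ^ 2 := by
  have hp : 0 < a ^ 2 + b ^ 2 + c ^ 2 := by nlinarith [sq_nonneg a]
  rw [div_pow, sq_sqrt hp.le, sub_pos, div_lt_one hp]
  linarith

lemma slit_pos (b c : ℝ) (h : (⟨b, c⟩ : ℂ) ∈ Complex.slitPlane) : 0 < b ^ 2 + c ^ 2 := by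
  rcases h with h | h
  · simp only at h; positivity
  · simp only at h; positivity

lemma phi_diff (x : E3) (h : (⟨x 1, x 2⟩ : ℂ) ∈ Complex.slitPlane) :
    DifferentiableAt ℝ sphPhi x := by
  have h1 : sphPhi = fun y : E3 => Complex.imCLM (Complex.log
      (Complex.equivRealProdCLM.symm (y 1, y 2))) := by
    funext y
    simp only [Complex.imCLM_apply, Complex.log_im]
    unfold sphPhi
    congr 1
  rw [h1]
  refine Complex.imCLM.differentiableAt.comp x ?_
  have h2 : DifferentiableAt ℝ Complex.log (Complex.equivRealProdCLM.symm (x 1, x 2)) := by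
    refine DifferentiableAt.restrictScalars ℝ (Complex.differentiableAt_log ?_)
    exact h
  have h3 : DifferentiableAt ℝ (fun y : E3 => Complex.equivRealProdCLM.symm (y 1, y 2)) x := by
    fun_prop
  exact DifferentiableAt.fun_comp' (g := Complex.log) x h2 h3

lemma rho_diff (x : E3) (h : 0 < x 1 ^ 2 + x 2 ^ 2) : DifferentiableAt ℝ sphRho x := by
  unfold sphRho
  refine DifferentiableAt.sqrt (by fun_prop) ?_
  nlinarith [sq_nonneg (x 0)]

lemma rho_pos (x : E3) (h : 0 < x 1 ^ 2 + x 2 ^ 2) : 0 < sphRho x := by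
  unfold sphRho
  apply Real.sqrt_pos.2
  nlinarith [sq_nonneg (x 0)]

lemma solidU_diff (k m : ℕ) (sgn : Bool) (x : E3) (h : (⟨x 1, x 2⟩ : ℂ) ∈ Complex.slitPlane) :
    DifferentiableAt ℝ (solidU (-(k + 1 : ℤ)) m sgn) x := by
  have hp := slit_pos _ _ h
  have hr := rho_diff x hp
  have hr0 := (rho_pos x hp).ne'
  have hφ := phi_diff x h
  rw [show solidU (-(k + 1 : ℤ)) m sgn = _ from funext (solidU_neg k m sgn)]
  have ht : DifferentiableAt ℝ (fun y : E3 => y 0 / sphRho y) x := by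
    have h0 : DifferentiableAt ℝ (fun y : E3 => y 0) x := by fun_prop
    simp only [div_eq_mul_inv]
    exact h0.mul (hr.inv hr0)
  refine ((hr.zpow (Or.inl hr0)).mul (DifferentiableAt.mul ?_ ?_)).mul ?_
  · refine DifferentiableAt.rpow_const ?_ (Or.inl (one_sub_pos _ _ _ hp).ne')
    exact (ht.pow 2).const_sub 1
  · exact (qPoly k m).differentiableAt.comp x ht
  · unfold PhiFac
    cases sgn
    · simp only [Bool.false_eq_true, if_false]
      fun_prop
    · simp only [if_true]
      fun_prop

lemma line_deriv (k m : ℕ) (a s : ℝ) (hs : 0 < s) :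
    HasDerivAt (fun u : ℝ => √(u ^ 2 + s) ^ (-(k + 1 : ℤ)) *
      ((1 - (u / √(u ^ 2 + s)) ^ 2) ^ ((m : ℝ) / 2) * (qPoly k m).eval (u / √(u ^ 2 + s))))
      (√(a ^ 2 + s) ^ (-(k + 2 : ℤ)) * ((1 - (a / √(a ^ 2 + s)) ^ 2) ^ ((m : ℝ) / 2) *
        Yfun k m (a / √(a ^ 2 + s)))) a := by
  have hp : 0 < a ^ 2 + s := by positivity
  have hr : HasDerivAt (fun u : ℝ => √(u ^ 2 + s)) (a / √(a ^ 2 + s)) a := by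
    have := (((hasDerivAt_id a).pow 2).add_const s).sqrt hp.ne'
    refine this.congr_deriv ?_
    simp; field_simp
  set r := √(a ^ 2 + s) with hrdef
  have hr0 : 0 < r := Real.sqrt_pos.2 hp
  have hr2 : r ^ 2 = a ^ 2 + s := sq_sqrt hp.le
  set t := a / r with ht
  have ht1 : 0 < 1 - t ^ 2 := by
    rw [ht, div_pow, hr2, sub_pos, div_lt_one hp]; linarith
  have hat : a = t * r := by rw [ht]; field_simp
  have hdt : HasDerivAt (fun u : ℝ => u / √(u ^ 2 + s)) ((1 - t ^ 2) / r) a := by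
    refine ((hasDerivAt_id a).div hr hr0.ne').congr_deriv ?_
    simp only [id, ← hrdef]
    rw [hat]
    field_simp
  have h1 := (hasDerivAt_zpow (-(k + 1 : ℤ)) r (Or.inl hr0.ne')).comp a hr
  have h2 := ((hdt.pow 2).const_sub 1).rpow_const (p := (m : ℝ) / 2) (Or.inl ht1.ne')
  have h3 := ((qPoly k m).hasDerivAt t).comp a hdt
  refine (h1.mul (h2.mul h3)).congr_deriv ?_
  simp only [Function.comp, Pi.pow_apply, ← hrdef, ← ht, Pi.mul_apply]
  rw [rpow_sub_one ht1.ne', Yfun]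
  have e1 : r ^ (-(k + 1 : ℤ) - 1) = r ^ (-(k + 2 : ℤ)) := by congr 1
  have e2 : r ^ (-(k + 1 : ℤ)) = r ^ (-(k + 2 : ℤ)) * r := by
    rw [← zpow_add_one₀ hr0.ne']; congr 1
  rw [e1, e2]
  generalize (1 - t ^ 2) ^ ((m : ℝ) / 2) = A
  generalize r ^ (-(k + 2 : ℤ)) = Z
  push_cast
  field_simp
  ring

lemma solidU_d0 (k m : ℕ) (sgn : Bool) (x : E3) (h : (⟨x 1, x 2⟩ : ℂ) ∈ Complex.slitPlane) :
    fderiv ℝ (solidU (-(k + 1 : ℤ)) m sgn) x (EuclideanSpace.single 0 1) =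
      sphRho x ^ (-(k + 2 : ℤ)) * ((1 - (x 0 / sphRho x) ^ 2) ^ ((m : ℝ) / 2) *
        Yfun k m (x 0 / sphRho x)) * PhiFac m sgn (sphPhi x) := by
  have hd := (solidU_diff k m sgn x h).hasFDerivAt
  have hl : HasDerivAt (fun u : ℝ => x + (u - x 0) • (EuclideanSpace.single 0 1 : E3))
      (EuclideanSpace.single 0 1 : E3) (x 0) := by
    have := (((hasDerivAt_id (x 0)).sub_const (x 0)).smul_const
      (EuclideanSpace.single 0 1 : E3)).const_add x
    simpa using this
  have hc := HasFDerivAt.comp_hasDerivAt_of_eq (x 0) hd hl (by simp)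
  have hl2 := (line_deriv k m (x 0) _ (slit_pos _ _ h)).mul_const (PhiFac m sgn (sphPhi x))
  have hfe : (solidU (-(k + 1 : ℤ)) m sgn ∘
      fun u : ℝ => x + (u - x 0) • (EuclideanSpace.single 0 1 : E3)) = fun u : ℝ =>
      √(u ^ 2 + (x 1 ^ 2 + x 2 ^ 2)) ^ (-(k + 1 : ℤ)) *
      ((1 - (u / √(u ^ 2 + (x 1 ^ 2 + x 2 ^ 2))) ^ 2) ^ ((m : ℝ) / 2) *
        (qPoly k m).eval (u / √(u ^ 2 + (x 1 ^ 2 + x 2 ^ 2)))) * PhiFac m sgn (sphPhi x) := by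
    funext u
    simp only [Function.comp, solidU_neg, sphRho, sphPhi]
    simp [add_assoc]
  rw [hfe] at hc
  rw [hc.unique hl2]
  simp only [sphRho, add_assoc]

lemma Xmon_re (k m : ℕ) (sgn : Bool) (n' : ℤ) (hn : n' + 1 = -(k + 1 : ℤ)) (x : E3)
    (h : (⟨x 1, x 2⟩ : ℂ) ∈ Complex.slitPlane) :
    (Xmon n' m sgn x).re =
      sphRho x ^ (-(k + 2 : ℤ)) * ((1 - (x 0 / sphRho x) ^ 2) ^ ((m : ℝ) / 2) *
        Yfun k m (x 0 / sphRho x)) * PhiFac m sgn (sphPhi x) := by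
  rw [← solidU_d0 k m sgn x h]
  unfold Xmon
  rw [hn]
  have hd := (solidU_diff k m sgn x h).hasFDerivAt
  have hq : HasFDerivAt (solidUq (-(k + 1 : ℤ)) m sgn)
      ((algebraMapCLM ℝ H).comp (fderiv ℝ (solidU (-(k + 1 : ℤ)) m sgn) x)) x :=
    (algebraMapCLM ℝ H).hasFDerivAt.comp x hd
  have hpd : ∀ i, pd i (solidUq (-(k + 1 : ℤ)) m sgn) x =
      ((fderiv ℝ (solidU (-(k + 1 : ℤ)) m sgn) x (EuclideanSpace.single i 1) : ℝ) : H) := by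
    intro i
    unfold pd
    rw [hq.fderiv]
    rfl
  rw [Dop, hpd, hpd, hpd]
  generalize fderiv ℝ (solidU (-(k + 1 : ℤ)) m sgn) x = L
  have h1 : ∀ r : ℝ, (qe1 * (r : H)).re = 0 := fun r => by
    rw [Quaternion.re_mul]; simp [qe1]
  have h2 : ∀ r : ℝ, (qe2 * (r : H)).re = 0 := fun r => by
    rw [Quaternion.re_mul]; simp [qe2]
  simp [h1, h2]

lemma main_zero (n n' : ℤ) (m' : ℕ) (sgn sgn' : Bool) (hn : n ≤ -2) (hn' : n' ≤ -2) :
    ∫ x in extB, solidU n (-n - 1).toNat sgn x * (Xmon n' m' sgn' x).re = 0 := by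
  obtain ⟨m, hm⟩ : ∃ m : ℕ, n = -(m + 1 : ℤ) := ⟨(-n - 1).toNat, by omega⟩
  obtain ⟨k, hk⟩ : ∃ k : ℕ, n' + 1 = -(k + 1 : ℤ) := ⟨(-n' - 2).toNat, by omega⟩
  have hm' : (-n - 1).toNat = m := by omega
  rw [hm']
  subst hm
  obtain ⟨c, hc⟩ := top_const m
  have hmeas : MeasurableSet extB :=
    (isOpen_lt continuous_const continuous_norm).measurableSet
  rw [← integral_indicator hmeas, e3_integral]
  refine sph_zero _ (fun ρ => (if 1 < ρ then 1 else 0) *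
      (ρ ^ (-(m + 1 : ℤ)) * ρ ^ (-(k + 2 : ℤ))))
    (fun θ => c * sin θ ^ m * (sin θ ^ m' * Yfun k m' (cos θ)))
    (fun φ => PhiFac m sgn φ * PhiFac m' sgn' φ) ?_ ?_
  · intro ρ θ φ hρ hθ hφ
    have hs := sin_pos_of_mem_Ioo hθ
    set x : E3 := !₂[ρ * cos θ, ρ * sin θ * cos φ, ρ * sin θ * sin φ] with hx
    have x0 : x 0 = ρ * cos θ := by simp [hx]
    have x1 : x 1 = ρ * sin θ * cos φ := by simp [hx]
    have x2 : x 2 = ρ * sin θ * sin φ := by simp [hx]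
    have hz : (⟨x 1, x 2⟩ : ℂ) = ((ρ * sin θ : ℝ) : ℂ) * (Complex.cos φ + Complex.sin φ * Complex.I) := by
      rw [x1, x2]
      apply Complex.ext <;> simp [← Complex.ofReal_cos, ← Complex.ofReal_sin]
    have hpos : 0 < ρ * sin θ := by positivity
    have hphi : sphPhi x = φ := by
      unfold sphPhi
      rw [hz, Complex.arg_mul_cos_add_sin_mul_I hpos ⟨hφ.1, hφ.2.le⟩]
    have hsq : x 0 ^ 2 + x 1 ^ 2 + x 2 ^ 2 = ρ ^ 2 := by
      rw [x0, x1, x2]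
      linear_combination (ρ ^ 2 * sin θ ^ 2) * sin_sq_add_cos_sq φ + ρ ^ 2 * sin_sq_add_cos_sq θ
    have hrho : sphRho x = ρ := by
      unfold sphRho
      rw [hsq, sqrt_sq hρ.le]
    have hslit : (⟨x 1, x 2⟩ : ℂ) ∈ Complex.slitPlane := by
      rw [Complex.mem_slitPlane_iff_arg]
      refine ⟨?_, ?_⟩
      · have : Complex.arg ⟨x 1, x 2⟩ = φ := hphi
        rw [this]; exact hφ.2.ne
      · intro h0
        have h1 := congrArg Complex.re h0
        have h2 := congrArg Complex.im h0
        simp only [Complex.zero_re, Complex.zero_im] at h1 h2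
        rw [x1] at h1
        rw [x2] at h2
        have := sin_sq_add_cos_sq φ
        have a1 : cos φ = 0 := (mul_eq_zero.1 h1).resolve_left hpos.ne'
        have a2 : sin φ = 0 := (mul_eq_zero.1 h2).resolve_left hpos.ne'
        rw [a1, a2] at this
        norm_num at this
    have hnorm : ‖x‖ = ρ := by
      rw [EuclideanSpace.norm_eq, Fin.sum_univ_three]
      simp only [Real.norm_eq_abs, sq_abs]
      rw [hsq, sqrt_sq hρ.le]
    have hdiv : x 0 / sphRho x = cos θ := by rw [hrho, x0]; field_simp
    have hsin : ∀ j : ℕ, (1 - cos θ ^ 2) ^ ((j : ℝ) / 2) = sin θ ^ j := by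
      intro j
      rw [← sin_sq, ← rpow_natCast (sin θ) 2, ← rpow_mul hs.le, ← rpow_natCast]
      congr 1
      push_cast; ring
    have hU := solidU_neg m m sgn x
    have hX := Xmon_re k m' sgn' n' hk x hslit
    rw [hdiv, hrho, hphi, hsin, ← legendre_q, hc] at hU
    rw [hdiv, hrho, hphi, hsin] at hX
    by_cases h1 : 1 < ρ
    · rw [Set.indicator_of_mem (by simpa [extB, hnorm] using h1), hU, hX, if_pos h1]
      ring
    · rw [Set.indicator_of_notMem (by simpa [extB, hnorm] using h1), if_neg h1]
      ring
  · by_cases h : m = m'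
    · left
      subst h
      exact theta_zero k m c
    · right
      exact phi_zero m m' sgn sgn' h

/-- for `n ≤ -2`, the scalar harmonic `U_{n,-n-1}^{±}` (as an
`𝒜`-valued function) is orthogonal in `L²(B^e)` to every basic monogenic
`X_{n',m'}^{±}` and every basic antimonogenic `X̄_{n',m'}^{±}`. -/
theorem stmt16 (n n' : ℤ) (m' : ℕ) (sgn sgn' : Bool) (hn : n ≤ -2) (hn' : n' ≤ -2)
    (hm' : (m' : ℤ) ≤ -n' - 2) :
    (∫ x in extB, qip (⟨solidU n (-n - 1).toNat sgn x, 0, 0, 0⟩ : H) (Xmon n' m' sgn' x)) = 0 ∧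
    (∫ x in extB,
        qip (⟨solidU n (-n - 1).toNat sgn x, 0, 0, 0⟩ : H) (star (Xmon n' m' sgn' x))) = 0 := by
  have h := main_zero n n' m' sgn sgn' hn hn'
  constructor
  · simpa [qip] using h
  · simpa [qip] using h

end
end

section
/- Let f be a square-integrable contragenic function on B^e = {x ∈ ℝ³ : |x| > 1}. Then the scalar part of f lies in the closed span of the harmonics {U_{n,-n-1}^{±} : n ≤ -2}; equivalently, Sc f is L²-orthogonal to every U_{n,m}^{±} with n ≤ -2 and 0 ≤ m ≤ -n-2. -/
open MeasureTheory Real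

noncomputable section

open Polynomial in
/-- Iterated derivative of `X * q`. -/
theorem iterD_X_mul (k : ℕ) (q : ℝ[X]) :
    derivative^[k + 1] (X * q) = X * derivative^[k + 1] q + (C ((k : ℝ) + 1)) * derivative^[k] q := by
  induction k with
  | zero => simp [derivative_mul, add_comm]
  | succ k ih =>
    rw [Function.iterate_succ_apply', ih]
    simp only [derivative_add, derivative_mul, derivative_X, derivative_C, zero_mul, zero_add,
      ← Function.iterate_succ_apply' (f := ⇑derivative)]
    push_cast
    simp only [map_add, map_one]
    ring

open Polynomial in
/-- The Legendre polynomial as an element of `ℝ[X]`. -/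
def LP (n : ℕ) : ℝ[X] :=
  C (1 / (2 ^ n * n.factorial : ℝ)) * derivative^[n] ((X ^ 2 - 1) ^ n)

open Polynomial in
theorem iterD_C_mul (k : ℕ) (c : ℝ) (q : ℝ[X]) :
    derivative^[k] (C c * q) = C c * derivative^[k] q := by
  simp

open Polynomial in
theorem iterD_half (n : ℕ) :
    derivative^[n + 1] (((X : ℝ[X]) ^ 2 - 1) ^ (n + 1))
      = C (2 * ((n : ℝ) + 1)) * derivative^[n] (X * (X ^ 2 - 1) ^ n) := by
  rw [Function.iterate_succ_apply, ← iterD_C_mul]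
  congr 1
  simp [derivative_pow, map_mul, map_add]
  ring

open Polynomial in
theorem LP_const (n : ℕ) :
    (1 / (2 ^ (n + 1) * (n + 1).factorial : ℝ)) * (2 * ((n : ℝ) + 1))
      = 1 / (2 ^ n * n.factorial : ℝ) := by
  have : (n.factorial : ℝ) ≠ 0 := by positivity
  have h2 : (n : ℝ) + 1 ≠ 0 := by positivity
  rw [Nat.factorial_succ]
  push_cast
  field_simp
  try ring

open Polynomial in
theorem LP_A (n : ℕ) :
    derivative (LP (n + 1)) = X * derivative (LP n) + C ((n : ℝ) + 1) * LP n := by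
  unfold LP
  rw [iterD_half, ← mul_assoc, ← C_mul, LP_const]
  simp only [derivative_C_mul, ← Function.iterate_succ_apply' (f := ⇑derivative)]
  rw [iterD_X_mul]
  ring

open Polynomial in
theorem LP_B (n : ℕ) :
    C ((n : ℝ) + 1) * LP (n + 1) = C ((n : ℝ) + 1) * X * LP n + (X ^ 2 - 1) * derivative (LP n) := by
  have h1 := iterD_half n
  have h2 : derivative^[n + 1] (((X : ℝ[X]) ^ 2 - 1) ^ (n + 1))
      = derivative^[n + 1] (X * (X * (X ^ 2 - 1) ^ n)) - derivative^[n + 1] ((X ^ 2 - 1) ^ n) := by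
    rw [← Polynomial.iterate_derivative_sub]
    congr 1
    ring
  rw [iterD_X_mul, iterD_X_mul] at h2
  have hL : C (2 * ((n : ℝ) + 1)) * LP (n + 1) = C (1 / (2 ^ n * n.factorial : ℝ)) *
      derivative^[n + 1] (((X : ℝ[X]) ^ 2 - 1) ^ (n + 1)) := by
    unfold LP
    rw [← LP_const n, C_mul (a := 1 / _)]
    ring
  have hd : derivative (LP n) = C (1 / (2 ^ n * n.factorial : ℝ)) *
      derivative^[n + 1] (((X : ℝ[X]) ^ 2 - 1) ^ n) := by
    unfold LP
    rw [derivative_C_mul, ← Function.iterate_succ_apply' (f := ⇑derivative)]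
  have h22 : (C (2 : ℝ) : ℝ[X]) = 2 := rfl
  rw [C_mul, h22] at hL h1
  have two : (2 : ℝ[X]) ≠ 0 := two_ne_zero
  apply mul_left_cancel₀ two
  rw [hd]
  unfold LP at hL ⊢
  generalize derivative^[n + 1] (((X : ℝ[X]) ^ 2 - 1) ^ (n + 1)) = a at *
  generalize derivative^[n] (((X : ℝ[X]) * (X ^ 2 - 1) ^ n)) = b at *
  generalize derivative^[n + 1] (((X : ℝ[X]) ^ 2 - 1) ^ n) = d1 at *
  generalize derivative^[n] (((X : ℝ[X]) ^ 2 - 1) ^ n) = d0 at *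
  generalize C (1 / (2 ^ n * n.factorial : ℝ)) = c at *
  linear_combination hL + 2 * c * h2 - c * h1

open Polynomial in
theorem LP_A_iter (n m : ℕ) :
    derivative^[m + 1] (LP (n + 1)) =
      X * derivative^[m + 1] (LP n) + C ((n : ℝ) + 1 + m) * derivative^[m] (LP n) := by
  induction m with
  | zero => simpa using LP_A n
  | succ m ih =>
    rw [Function.iterate_succ_apply', ih]
    simp only [derivative_add, derivative_mul, derivative_X, derivative_C, zero_mul, zero_add,
      ← Function.iterate_succ_apply' (f := ⇑derivative)]
    push_cast
    simp only [map_add, map_one]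
    ring

open Polynomial in
theorem LP_B_iter (n m : ℕ) :
    (1 - X ^ 2) * derivative^[m + 1] (LP n) =
      C ((n : ℝ) + 1 + m) * X * derivative^[m] (LP n)
        - C ((n : ℝ) + 1 - m) * derivative^[m] (LP (n + 1)) := by
  induction m with
  | zero =>
    have := LP_B n
    simp at this ⊢
    linear_combination this
  | succ m ih =>
    have h := congrArg derivative ih
    simp only [derivative_sub, derivative_mul, derivative_X, derivative_C,
      zero_mul, zero_add, derivative_one, derivative_X_pow,
      ← Function.iterate_succ_apply' (f := ⇑derivative)] at h
    have hA := LP_A_iter n m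
    simp only [map_add, map_sub, map_one, Nat.cast_add, Nat.cast_one, Nat.cast_ofNat,
      map_natCast, Nat.succ_eq_add_one] at h hA ⊢
    have h22 : (C (2 : ℝ) : ℝ[X]) = 2 := rfl
    simp only [h22, pow_one, zero_sub, show 2 - 1 = 1 from rfl] at h
    linear_combination h - hA

open Polynomial in
theorem LP_C_iter (n m : ℕ) :
    (1 - X ^ 2) * derivative^[m + 2] (LP n) - 2 * C ((m : ℝ) + 1) * X * derivative^[m + 1] (LP n)
      + C (((n : ℝ) + 1 + m) * (n - m)) * derivative^[m] (LP n) = 0 := by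
  have hA := LP_A_iter n m
  have h := LP_B_iter n m
  have h' := LP_B_iter n (m + 1)
  simp only [map_add, map_sub, map_mul, map_one, Nat.cast_add, Nat.cast_one,
      map_natCast] at h hA h' ⊢
  linear_combination h' - ((n : ℝ[X]) - m) * hA

open Polynomial in
theorem iteratedDeriv_eval (k : ℕ) (p : ℝ[X]) :
    iteratedDeriv k (fun t => p.eval t) = fun t => (derivative^[k] p).eval t := by
  induction k with
  | zero => simp
  | succ k ih =>
    rw [iteratedDeriv_succ, ih, Function.iterate_succ_apply']
    funext t
    exact Polynomial.deriv _

open Polynomial in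
theorem legendreP_eq (n : ℕ) : legendreP n = fun t => (LP n).eval t := by
  funext t
  have : (fun s : ℝ => (s ^ 2 - 1) ^ n) = fun s => (((X : ℝ[X]) ^ 2 - 1) ^ n).eval s := by
    funext s; simp
  rw [legendreP, this, iteratedDeriv_eval, LP, eval_mul, eval_C]

open Polynomial in
theorem assocLegendreNat_eq (n m : ℕ) (t : ℝ) : assocLegendreNat n m t =
    (1 - t ^ 2) ^ ((m : ℝ) / 2) * (derivative^[m] (LP n)).eval t := by
  rw [assocLegendreNat, legendreP_eq, iteratedDeriv_eval]

/-- The coordinate functionals. -/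
def prj (i : Fin 3) : E3 →L[ℝ] ℝ := EuclideanSpace.proj i

/-- `f` is differentiable at `x` with gradient `(a, b, c)`. -/
def Grad (f : E3 → ℝ) (a b c : ℝ) (x : E3) : Prop :=
  HasFDerivAt f (a • prj 0 + b • prj 1 + c • prj 2) x

theorem Grad.congr {f : E3 → ℝ} {a b c a' b' c' : ℝ} {x : E3} (h : Grad f a b c x)
    (ha : a = a') (hb : b = b') (hc : c = c') : Grad f a' b' c' x := by
  subst ha hb hc; exact h

theorem Grad.mul {f g : E3 → ℝ} {a b c a' b' c' : ℝ} {x : E3} (h : Grad f a b c x)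
    (h' : Grad g a' b' c' x) :
    Grad (fun y => f y * g y) (a * g x + f x * a') (b * g x + f x * b') (c * g x + f x * c') x := by
  have := HasFDerivAt.mul h h'
  unfold Grad
  refine HasFDerivAt.congr_fderiv this ?_
  ext v
  simp
  ring

theorem Grad.add {f g : E3 → ℝ} {a b c a' b' c' : ℝ} {x : E3} (h : Grad f a b c x)
    (h' : Grad g a' b' c' x) :
    Grad (fun y => f y + g y) (a + a') (b + b') (c + c') x := by
  have := HasFDerivAt.add h h'
  unfold Grad
  refine HasFDerivAt.congr_fderiv this ?_
  ext v
  simp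
  ring

theorem Grad.comp {f : E3 → ℝ} {a b c : ℝ} {x : E3} (h : Grad f a b c x) {φ : ℝ → ℝ} {d : ℝ}
    (hφ : HasDerivAt φ d (f x)) :
    Grad (fun y => φ (f y)) (d * a) (d * b) (d * c) x := by
  have := hφ.comp_hasFDerivAt x h
  unfold Grad
  refine HasFDerivAt.congr_fderiv this ?_
  ext v
  simp
  ring

theorem grad_x0 (x : E3) : Grad (fun y => y 0) 1 0 0 x := by
  unfold Grad
  refine HasFDerivAt.congr_fderiv (prj 0).hasFDerivAt ?_
  simp
theorem grad_x1 (x : E3) : Grad (fun y => y 1) 0 1 0 x := by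
  unfold Grad
  refine HasFDerivAt.congr_fderiv (prj 1).hasFDerivAt ?_
  simp
theorem grad_x2 (x : E3) : Grad (fun y => y 2) 0 0 1 x := by
  unfold Grad
  refine HasFDerivAt.congr_fderiv (prj 2).hasFDerivAt ?_
  simp

theorem sphRho_eq (x : E3) : sphRho x = ‖x‖ := by
  rw [sphRho, EuclideanSpace.norm_eq, Fin.sum_univ_three]
  simp

theorem sphRho_sq (x : E3) : sphRho x ^ 2 = x 0 ^ 2 + x 1 ^ 2 + x 2 ^ 2 := by
  rw [sphRho, Real.sq_sqrt (by positivity)]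

theorem grad_rho {x : E3} (hx : 0 < sphRho x) :
    Grad sphRho (x 0 / sphRho x) (x 1 / sphRho x) (x 2 / sphRho x) x := by
  have h0 := (grad_x0 x).mul (grad_x0 x)
  have h1 := (grad_x1 x).mul (grad_x1 x)
  have h2 := (grad_x2 x).mul (grad_x2 x)
  have h := (h0.add h1).add h2
  have hne : x 0 * x 0 + x 1 * x 1 + x 2 * x 2 ≠ 0 := by
    have := sphRho_sq x
    have : 0 < sphRho x ^ 2 := by positivity
    nlinarith
  have e : sphRho = fun y : E3 => Real.sqrt (y 0 * y 0 + y 1 * y 1 + y 2 * y 2) := by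
    funext y; simp only [sphRho, sq]
  have k := h.comp (Real.hasDerivAt_sqrt hne)
  rw [← e] at k
  have e2 : Real.sqrt (x 0 * x 0 + x 1 * x 1 + x 2 * x 2) = sphRho x := (congrFun e x).symm
  rw [e2] at k
  refine k.congr ?_ ?_ ?_ <;> field_simp <;> ring

/-- `ρ^{-k} Q(x₀/ρ)`. -/
def FF (k : ℕ) (Q : Polynomial ℝ) (x : E3) : ℝ :=
  (sphRho x)⁻¹ ^ k * Q.eval (x 0 / sphRho x)

/-- The polynomial `-kQ - XQ'`. -/
def RR (k : ℕ) (Q : Polynomial ℝ) : Polynomial ℝ :=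
  -(Polynomial.C (k : ℝ) * Q) - Polynomial.X * Polynomial.derivative Q

theorem grad_FF {x : E3} (hx : 0 < sphRho x) (k : ℕ) (Q : Polynomial ℝ) :
    Grad (FF k Q) (FF (k + 1) (Polynomial.derivative Q) x + x 0 * FF (k + 2) (RR k Q) x)
      (x 1 * FF (k + 2) (RR k Q) x) (x 2 * FF (k + 2) (RR k Q) x) x := by
  have hr := (grad_rho hx).comp (hasDerivAt_inv hx.ne')
  have ht := (grad_x0 x).mul hr
  have hQ := ht.comp (Q.hasDerivAt _)
  have hk := hr.comp (hasDerivAt_pow k _)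
  have := hk.mul hQ
  have e : FF k Q = fun y => ((sphRho y)⁻¹ ^ k * Q.eval (y 0 * (sphRho y)⁻¹)) := by
    funext y; rw [FF, div_eq_mul_inv]
  rw [← e] at this
  refine this.congr ?_ ?_ ?_
  all_goals
    simp only [FF, RR, Polynomial.eval_sub, Polynomial.eval_neg, Polynomial.eval_mul,
      Polynomial.eval_C, Polynomial.eval_X, div_eq_mul_inv]
    generalize Polynomial.eval _ Q = q
    generalize Polynomial.eval _ (Polynomial.derivative Q) = q'
    rcases k with _ | k
    · simp
      try field_simp
      try ring
    · simp only [Nat.add_sub_cancel]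
      ring

/-- `Re (c (x₁ + i x₂)^m)`. -/
def HH (c : ℂ) (m : ℕ) (x : E3) : ℝ := (c * (⟨x 1, x 2⟩ : ℂ) ^ m).re

theorem HH_succ (c : ℂ) (m : ℕ) (x : E3) :
    HH c (m + 1) x = x 1 * HH c m x + x 2 * HH (c * Complex.I) m x := by
  simp only [HH, pow_succ]
  generalize (⟨x 1, x 2⟩ : ℂ) ^ m = w
  simp
  ring

theorem HH_nat (j : ℕ) (c : ℂ) (m : ℕ) (x : E3) : HH (j * c) m x = j * HH c m x := by
  simp only [HH]
  generalize (⟨x 1, x 2⟩ : ℂ) ^ m = w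
  simp
  ring

theorem HH_II (c : ℂ) (m : ℕ) (x : E3) : HH (c * Complex.I * Complex.I) m x = - HH c m x := by
  rw [mul_assoc, Complex.I_mul_I]
  simp [HH]

theorem grad_HH (c : ℂ) (m : ℕ) (x : E3) :
    Grad (HH c m) 0 (m * HH c (m - 1) x) (m * HH (c * Complex.I) (m - 1) x) x := by
  induction m generalizing c with
  | zero =>
    have : HH c 0 = fun _ => c.re := by funext y; simp [HH]
    rw [this]
    unfold Grad
    simpa using hasFDerivAt_const c.re x
  | succ m ih =>
    have e : HH c (m + 1) = fun y => y 1 * HH c m y + y 2 * HH (c * Complex.I) m y := by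
      funext y; exact HH_succ c m y
    rw [e]
    have := ((grad_x1 x).mul (ih c)).add ((grad_x2 x).mul (ih (c * Complex.I)))
    rcases m with _ | m
    · refine this.congr ?_ ?_ ?_ <;> simp
    · refine this.congr ?_ ?_ ?_
      · simp
      · simp only [Nat.add_sub_cancel, HH_succ]
        push_cast
        ring
      · simp only [Nat.add_sub_cancel, HH_succ, HH_II]
        push_cast
        ring

/-- The three partial derivatives of `V = FF k Q * HH c m`. -/
def V0 (k : ℕ) (Q : Polynomial ℝ) (c : ℂ) (m : ℕ) (x : E3) : ℝ :=
  (FF (k + 1) (Polynomial.derivative Q) x + x 0 * FF (k + 2) (RR k Q) x) * HH c m x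
def V1 (k : ℕ) (Q : Polynomial ℝ) (c : ℂ) (m : ℕ) (x : E3) : ℝ :=
  x 1 * FF (k + 2) (RR k Q) x * HH c m x + FF k Q x * (m * HH c (m - 1) x)
def V2 (k : ℕ) (Q : Polynomial ℝ) (c : ℂ) (m : ℕ) (x : E3) : ℝ :=
  x 2 * FF (k + 2) (RR k Q) x * HH c m x + FF k Q x * (m * HH (c * Complex.I) (m - 1) x)

theorem grad_const (a : ℝ) (x : E3) : Grad (fun _ => a) 0 0 0 x := by
  unfold Grad
  simpa using hasFDerivAt_const a x

theorem V_grads {x : E3} (hx : 0 < sphRho x) (k : ℕ) (Q : Polynomial ℝ) (c : ℂ) (m : ℕ)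
    (hQ : ∀ t, (1 - t ^ 2) * (Polynomial.derivative (Polynomial.derivative Q)).eval t
      - 2 * (m + 1) * t * (Polynomial.derivative Q).eval t
      + (k : ℝ) * (k - 1 - 2 * m) * Q.eval t = 0) :
    ∃ a00 a01 a02 a11 a12 a22 : ℝ, Grad (V0 k Q c m) a00 a01 a02 x ∧
      Grad (V1 k Q c m) a01 a11 a12 x ∧ Grad (V2 k Q c m) a02 a12 a22 x ∧
      a00 + a11 + a22 = 0 := by
  have g0 := (((grad_FF hx (k + 1) (Polynomial.derivative Q)).add
    ((grad_x0 x).mul (grad_FF hx (k + 2) (RR k Q)))).mul (grad_HH c m x))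
  have g1 := ((((grad_x1 x).mul (grad_FF hx (k + 2) (RR k Q)))).mul (grad_HH c m x)).add
    ((grad_FF hx k Q).mul ((grad_const (m : ℝ) x).mul (grad_HH c (m - 1) x)))
  have g2 := ((((grad_x2 x).mul (grad_FF hx (k + 2) (RR k Q)))).mul (grad_HH c m x)).add
    ((grad_FF hx k Q).mul ((grad_const (m : ℝ) x).mul (grad_HH (c * Complex.I) (m - 1) x)))
  have hR : RR (k + 1) (Polynomial.derivative Q) = Polynomial.derivative (RR k Q) := by
    simp only [RR, Polynomial.derivative_sub, Polynomial.derivative_neg, Polynomial.derivative_mul,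
      Polynomial.derivative_C, Polynomial.derivative_X]
    push_cast
    simp only [map_add, map_one]
    ring
  refine ⟨_, _, _, _, _, _, g0, g1.congr ?_ rfl rfl, g2.congr ?_ ?_ rfl, ?_⟩
  · rw [hR]; ring
  · rw [hR]; ring
  · ring
  · have hE : x 1 * (m * HH c (m - 1) x) + x 2 * (m * HH (c * Complex.I) (m - 1) x)
        = m * HH c m x := by
      rcases m with _ | m
      · simp
      · simp only [Nat.add_sub_cancel, HH_succ]
        ring
    have hs := sphRho_sq x
    have hq := hQ (x 0 / sphRho x)
    rw [hR, HH_II]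
    have hRd : Polynomial.derivative (RR k Q) = -(Polynomial.C ((k : ℝ) + 1) *
        Polynomial.derivative Q) - Polynomial.X * Polynomial.derivative
          (Polynomial.derivative Q) := by
      rw [← hR, RR]; push_cast; rfl
    have e1 : FF (k + 1 + 1) (Polynomial.derivative (Polynomial.derivative Q)) x =
      (sphRho x)⁻¹ ^ (k + 2) *
        (Polynomial.derivative (Polynomial.derivative Q)).eval (x 0 / sphRho x) := rfl
    have e2 : x 0 * FF (k + 1 + 2) (Polynomial.derivative (RR k Q)) x = (sphRho x)⁻¹ ^ (k + 2) *
        ((x 0 / sphRho x) * (Polynomial.derivative (RR k Q)).eval (x 0 / sphRho x)) := by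
      rw [FF, show k + 1 + 2 = k + 2 + 1 from rfl, pow_succ, div_eq_mul_inv]; ring
    have e2' : x 0 * FF (k + 2 + 1) (Polynomial.derivative (RR k Q)) x = (sphRho x)⁻¹ ^ (k + 2) *
        ((x 0 / sphRho x) * (Polynomial.derivative (RR k Q)).eval (x 0 / sphRho x)) := e2
    have e3 : FF (k + 2) (RR k Q) x =
      (sphRho x)⁻¹ ^ (k + 2) * (RR k Q).eval (x 0 / sphRho x) := rfl
    have e4 : (x 0 ^ 2 + x 1 ^ 2 + x 2 ^ 2) * FF (k + 2 + 2) (RR (k + 2) (RR k Q)) x =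
      (sphRho x)⁻¹ ^ (k + 2) * (RR (k + 2) (RR k Q)).eval (x 0 / sphRho x) := by
      rw [← hs, FF, pow_add _ (k + 2) 2]
      field_simp
    have e5 : (RR (k + 2) (RR k Q)).eval (x 0 / sphRho x) =
      -((k + 2) * (RR k Q).eval (x 0 / sphRho x)) -
        x 0 / sphRho x * (Polynomial.derivative (RR k Q)).eval (x 0 / sphRho x) := by
      simp only [RR, Polynomial.eval_sub, Polynomial.eval_neg, Polynomial.eval_mul,
        Polynomial.eval_C, Polynomial.eval_X]
      push_cast
      rfl
    rw [e5] at e4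
    rw [hRd] at e2 e2' e4 ⊢
    have e6 : (RR k Q).eval (x 0 / sphRho x) = -(k * Q.eval (x 0 / sphRho x)) -
        x 0 / sphRho x * (Polynomial.derivative Q).eval (x 0 / sphRho x) := by
      simp only [RR, Polynomial.eval_sub, Polynomial.eval_neg, Polynomial.eval_mul,
        Polynomial.eval_C, Polynomial.eval_X]
    rw [e6] at e3 e4
    simp only [Polynomial.eval_sub, Polynomial.eval_neg, Polynomial.eval_mul,
        Polynomial.eval_C, Polynomial.eval_X] at e2 e2' e4
    generalize (sphRho x)⁻¹ ^ (k + 2) = w at *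
    generalize x 0 / sphRho x = t at *
    linear_combination HH c m x * (e1 + e2 + e2' + e4 + 3 * e3 + w * hq) +
      2 * FF (k + 2) (RR k Q) x * hE + 2 * m * HH c m x * e3

/-- `f = O(ρ^j)` on the exterior domain. -/
def Bd (f : E3 → ℝ) (j : ℤ) : Prop :=
  ∃ C : ℝ, 0 ≤ C ∧ ∀ x : E3, 1 < sphRho x → |f x| ≤ C * sphRho x ^ j

theorem Bd.mono {f : E3 → ℝ} {i j : ℤ} (h : Bd f i) (hij : i ≤ j) : Bd f j := by
  obtain ⟨C, hC, h⟩ := h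
  refine ⟨C, hC, fun x hx => (h x hx).trans ?_⟩
  have := zpow_le_zpow_right₀ hx.le hij
  gcongr

theorem Bd.add {f g : E3 → ℝ} {j : ℤ} (h : Bd f j) (h' : Bd g j) :
    Bd (fun x => f x + g x) j := by
  obtain ⟨C, hC, h⟩ := h
  obtain ⟨C', hC', h'⟩ := h'
  refine ⟨C + C', by positivity, fun x hx => (abs_add_le _ _).trans ?_⟩
  rw [add_mul]
  exact add_le_add (h x hx) (h' x hx)

theorem Bd.mul {f g : E3 → ℝ} {i j : ℤ} (h : Bd f i) (h' : Bd g j) :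
    Bd (fun x => f x * g x) (i + j) := by
  obtain ⟨C, hC, h⟩ := h
  obtain ⟨C', hC', h'⟩ := h'
  refine ⟨C * C', by positivity, fun x hx => ?_⟩
  have h0 : 0 < sphRho x := by linarith
  rw [abs_mul, zpow_add₀ h0.ne']
  calc |f x| * |g x| ≤ (C * sphRho x ^ i) * (C' * sphRho x ^ j) :=
        mul_le_mul (h x hx) (h' x hx) (abs_nonneg _) (by positivity)
    _ = _ := by ring

theorem abs_coord_le (x : E3) (i : Fin 3) : |x i| ≤ sphRho x := by
  refine abs_le_of_sq_le_sq ?_ (Real.sqrt_nonneg _)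
  change x i ^ 2 ≤ sphRho x ^ 2
  rw [sphRho_sq]
  fin_cases i <;> simp <;> nlinarith [sq_nonneg (x 0), sq_nonneg (x 1), sq_nonneg (x 2)]

theorem bd_coord (i : Fin 3) : Bd (fun x => x i) 1 :=
  ⟨1, zero_le_one, fun x _ => by simpa using abs_coord_le x i⟩

theorem bd_FF (k : ℕ) (Q : Polynomial ℝ) : Bd (FF k Q) (-(k : ℤ)) := by
  obtain ⟨C, hC⟩ := (isCompact_Icc (a := (-1 : ℝ)) (b := 1)).exists_bound_of_continuousOn
    Q.continuous.continuousOn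
  refine ⟨|C|, abs_nonneg _, fun x hx => ?_⟩
  have h0 : 0 < sphRho x := by linarith
  have ht : x 0 / sphRho x ∈ Set.Icc (-1 : ℝ) 1 := by
    rw [Set.mem_Icc, ← abs_le, abs_div, abs_of_pos h0, div_le_one h0]
    exact abs_coord_le x 0
  have := (hC _ ht).trans (le_abs_self C)
  rw [Real.norm_eq_abs] at this
  rw [FF, abs_mul, abs_of_pos (by positivity), zpow_neg, zpow_natCast, inv_pow, mul_comm]
  gcongr

theorem norm_z (x : E3) : ‖(⟨x 1, x 2⟩ : ℂ)‖ ^ 2 = x 1 ^ 2 + x 2 ^ 2 := by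
  rw [Complex.sq_norm, Complex.normSq_mk]; ring

theorem bd_HH (c : ℂ) (m : ℕ) : Bd (HH c m) m := by
  refine ⟨‖c‖, norm_nonneg _, fun x hx => (Complex.abs_re_le_norm _).trans ?_⟩
  rw [norm_mul, norm_pow, zpow_natCast]
  have : ‖(⟨x 1, x 2⟩ : ℂ)‖ ≤ sphRho x := by
    refine le_of_sq_le_sq ?_ (Real.sqrt_nonneg _)
    rw [norm_z, sphRho_sq]
    nlinarith [sq_nonneg (x 0)]
  gcongr

theorem bd_mHH (c : ℂ) (m : ℕ) : Bd (fun x => m * HH c (m - 1) x) ((m : ℤ) - 1) := by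
  rcases m with _ | m
  · refine ⟨0, le_rfl, fun x _ => by simp⟩
  · have h : Bd (fun _ => ((m + 1 : ℕ) : ℝ)) 0 :=
      ⟨((m + 1 : ℕ) : ℝ), by positivity, fun x _ => by
        rw [abs_of_nonneg (by positivity)]; simp⟩
    refine (h.mul (bd_HH c m)).mono ?_
    push_cast; omega

theorem bd_V0 (k : ℕ) (Q : Polynomial ℝ) (c : ℂ) (m : ℕ) (h : m + 1 ≤ k) :
    Bd (V0 k Q c m) (-2) := by
  have h1 := ((bd_FF (k + 1) (Polynomial.derivative Q)).mono (j := -(k : ℤ) - 1)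
    (by push_cast; omega)).add
    (((bd_coord 0).mul (bd_FF (k + 2) (RR k Q))).mono (j := -(k : ℤ) - 1) (by push_cast; omega))
  exact (h1.mul (bd_HH c m)).mono (by omega)

theorem bd_V1 (k : ℕ) (Q : Polynomial ℝ) (c : ℂ) (m : ℕ) (h : m + 1 ≤ k) :
    Bd (V1 k Q c m) (-2) := by
  have h1 := (((bd_coord 1).mul (bd_FF (k + 2) (RR k Q))).mul (bd_HH c m)).mono (j := -2)
    (by push_cast; omega)
  exact h1.add (((bd_FF k Q).mul (bd_mHH c m)).mono (by omega))

theorem bd_V2 (k : ℕ) (Q : Polynomial ℝ) (c : ℂ) (m : ℕ) (h : m + 1 ≤ k) :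
    Bd (V2 k Q c m) (-2) := by
  have h1 := (((bd_coord 2).mul (bd_FF (k + 2) (RR k Q))).mul (bd_HH c m)).mono (j := -2)
    (by push_cast; omega)
  exact h1.add (((bd_FF k Q).mul (bd_mHH (c * Complex.I) m)).mono (by omega))

/-- The constant selecting real or imaginary part. -/
def cc (sgn : Bool) : ℂ := if sgn then 1 else -Complex.I

theorem HH_polar (sgn : Bool) (m : ℕ) (x : E3) :
    HH (cc sgn) m x = ‖(⟨x 1, x 2⟩ : ℂ)‖ ^ m * PhiFac m sgn (sphPhi x) := by
  have h := Complex.norm_mul_cos_add_sin_mul_I (⟨x 1, x 2⟩ : ℂ)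
  rw [HH, PhiFac, sphPhi]
  conv_lhs => rw [← h]
  rw [mul_pow, Complex.cos_add_sin_mul_I_pow]
  generalize Complex.arg (⟨x 1, x 2⟩ : ℂ) = a
  generalize ‖(⟨x 1, x 2⟩ : ℂ)‖ = r
  have e1 : Complex.cos (m * (a : ℂ)) = ((Real.cos (m * a) : ℝ) : ℂ) := by push_cast; rfl
  have e2 : Complex.sin (m * (a : ℂ)) = ((Real.sin (m * a) : ℝ) : ℂ) := by push_cast; rfl
  rw [e1, e2, ← Complex.ofReal_pow]
  generalize Real.cos (m * a) = u
  generalize Real.sin (m * a) = v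
  generalize r ^ m = w
  cases sgn <;> simp [cc]

open Polynomial in
theorem solidU_eq (N m : ℕ) (sgn : Bool) {x : E3} (hx : 0 < sphRho x) :
    solidU (-((N : ℤ) + 1)) m sgn x =
      FF (N + 1 + m) (derivative^[m] (LP N)) x * HH (cc sgn) m x := by
  have h1 : ¬ (0 : ℤ) ≤ -((N : ℤ) + 1) := by omega
  have h2 : (-(-((N : ℤ) + 1)) - 1).toNat = N := by omega
  rw [solidU, assocLegendre, if_neg h1, h2, assocLegendreNat_eq, HH_polar, FF]
  have h3 : 1 - (x 0 / sphRho x) ^ 2 = (‖(⟨x 1, x 2⟩ : ℂ)‖ / sphRho x) ^ 2 := by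
    rw [div_pow, div_pow, norm_z]
    have := sphRho_sq x
    field_simp
    linarith
  have h4 : (1 - (x 0 / sphRho x) ^ 2) ^ ((m : ℝ) / 2) = (‖(⟨x 1, x 2⟩ : ℂ)‖ / sphRho x) ^ m := by
    rw [h3, ← Real.rpow_natCast _ 2, ← Real.rpow_mul (by positivity), ← Real.rpow_natCast _ m]
    congr 1
    push_cast
    ring
  have h5 : sphRho x ^ (-((N : ℤ) + 1)) = (sphRho x)⁻¹ ^ (N + 1) := by
    rw [zpow_neg, inv_pow]
    norm_cast
  rw [h4, h5, pow_add _ (N + 1) m, div_eq_mul_inv _ (sphRho x), mul_pow]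
  ring

open Polynomial in
theorem V0_eq (M m : ℕ) (c : ℂ) (x : E3) :
    V0 (M + 1 + m) (derivative^[m] (LP M)) c m x =
      -((M : ℝ) + 1 - m) * (FF (M + 1 + 1 + m) (derivative^[m] (LP (M + 1))) x * HH c m x) := by
  have h := congrArg (Polynomial.eval (x 0 / sphRho x)) (LP_B_iter M m)
  rw [Function.iterate_succ_apply'] at h
  simp only [Polynomial.eval_sub, Polynomial.eval_mul, Polynomial.eval_pow,
        Polynomial.eval_C, Polynomial.eval_X, Polynomial.eval_one] at h
  have e2 : x 0 * FF (M + 1 + m + 2) (RR (M + 1 + m) (derivative^[m] (LP M))) x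
      = (sphRho x)⁻¹ ^ (M + 1 + m + 1) * ((x 0 / sphRho x) *
        (RR (M + 1 + m) (derivative^[m] (LP M))).eval (x 0 / sphRho x)) := by
    rw [FF, show M + 1 + m + 2 = M + 1 + m + 1 + 1 from rfl, pow_succ, div_eq_mul_inv]; ring
  rw [V0, e2, FF, FF, RR, show M + 1 + 1 + m = M + 1 + m + 1 by ring]
  simp only [Polynomial.eval_sub, Polynomial.eval_neg, Polynomial.eval_mul,
        Polynomial.eval_C, Polynomial.eval_X]
  push_cast
  linear_combination (sphRho x)⁻¹ ^ (M + 1 + m + 1) * HH c m x * h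

theorem combo (a b c : ℝ) : a • (1 : H) + b • qe1 + c • qe2 = (⟨a, b, c, 0⟩ : H) := by
  have r1 : qe1.re = 0 := rfl
  have r2 : qe1.imI = 1 := rfl
  have r3 : qe1.imJ = 0 := rfl
  have r4 : qe1.imK = 0 := rfl
  have s1 : qe2.re = 0 := rfl
  have s2 : qe2.imI = 0 := rfl
  have s3 : qe2.imJ = 1 := rfl
  have s4 : qe2.imK = 0 := rfl
  have t1 : (1 : H).re = 1 := rfl
  have t2 : (1 : H).imI = 0 := rfl
  have t3 : (1 : H).imJ = 0 := rfl
  have t4 : (1 : H).imK = 0 := rfl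
  ext <;> simp [r1, r2, r3, r4, s1, s2, s3, s4, t1, t2, t3, t4]

/-- `V0 + ε (e₁ V1 + e₂ V2)`. -/
def GG (ε : ℝ) (k : ℕ) (Q : Polynomial ℝ) (c : ℂ) (m : ℕ) (x : E3) : H :=
  V0 k Q c m x • (1 : H) + (ε * V1 k Q c m x) • qe1 + (ε * V2 k Q c m x) • qe2

theorem GG_re (ε : ℝ) (k : ℕ) (Q : Polynomial ℝ) (c : ℂ) (m : ℕ) (x : E3) :
    (GG ε k Q c m x).re = V0 k Q c m x := by
  rw [GG, combo]
theorem GG_imI (ε : ℝ) (k : ℕ) (Q : Polynomial ℝ) (c : ℂ) (m : ℕ) (x : E3) :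
    (GG ε k Q c m x).imI = ε * V1 k Q c m x := by
  rw [GG, combo]
theorem GG_imJ (ε : ℝ) (k : ℕ) (Q : Polynomial ℝ) (c : ℂ) (m : ℕ) (x : E3) :
    (GG ε k Q c m x).imJ = ε * V2 k Q c m x := by
  rw [GG, combo]
theorem GG_imK (ε : ℝ) (k : ℕ) (Q : Polynomial ℝ) (c : ℂ) (m : ℕ) (x : E3) :
    (GG ε k Q c m x).imK = 0 := by
  rw [GG, combo]

theorem GG_fderiv (ε : ℝ) (k : ℕ) (Q : Polynomial ℝ) (c : ℂ) (m : ℕ) {x : E3}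
    {a00 a01 a02 a11 a12 a22 : ℝ} (h0 : Grad (V0 k Q c m) a00 a01 a02 x)
    (h1 : Grad (V1 k Q c m) a01 a11 a12 x) (h2 : Grad (V2 k Q c m) a02 a12 a22 x) :
    DifferentiableAt ℝ (GG ε k Q c m) x ∧
    pd 0 (GG ε k Q c m) x = ⟨a00, ε * a01, ε * a02, 0⟩ ∧
    pd 1 (GG ε k Q c m) x = ⟨a01, ε * a11, ε * a12, 0⟩ ∧
    pd 2 (GG ε k Q c m) x = ⟨a02, ε * a12, ε * a22, 0⟩ := by
  have h := ((HasFDerivAt.smul_const h0 (1 : H)).add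
    (HasFDerivAt.smul_const (HasFDerivAt.const_mul h1 ε) qe1)).add
    (HasFDerivAt.smul_const (HasFDerivAt.const_mul h2 ε) qe2)
  change HasFDerivAt (GG ε k Q c m) _ x at h
  refine ⟨h.differentiableAt, ?_, ?_, ?_⟩
  all_goals
    rw [pd, h.fderiv]
    rw [add_apply, add_apply,
      ContinuousLinearMap.smulRight_apply, ContinuousLinearMap.smulRight_apply,
      ContinuousLinearMap.smulRight_apply, combo]
    simp [prj]
    rfl

theorem Dbar_zero (g : E3 → H) (x : E3)
    (h0 : (pd 0 g x).re - (pd 1 g x).imI - (pd 2 g x).imJ = 0)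
    (h1 : (pd 0 g x).imI + (pd 1 g x).re + (pd 2 g x).imK = 0)
    (h2 : (pd 0 g x).imJ - (pd 1 g x).imK + (pd 2 g x).re = 0)
    (h3 : (pd 0 g x).imK + (pd 1 g x).imJ - (pd 2 g x).imI = 0) : Dbar g x = 0 := by
  have r1 : qe1.re = 0 := rfl
  have r2 : qe1.imI = 1 := rfl
  have r3 : qe1.imJ = 0 := rfl
  have r4 : qe1.imK = 0 := rfl
  have s1 : qe2.re = 0 := rfl
  have s2 : qe2.imI = 0 := rfl
  have s3 : qe2.imJ = 1 := rfl
  have s4 : qe2.imK = 0 := rfl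
  rw [Dbar]
  generalize pd 0 g x = p at *
  generalize pd 1 g x = q at *
  generalize pd 2 g x = r at *
  refine Quaternion.ext (R := ℝ) _ _ ?_ ?_ ?_ ?_
  · refine Eq.trans (b := (0 : ℝ)) ?_ rfl
    simp [r1, r2, r3, r4, s1, s2, s3, s4]
    linarith
  · refine Eq.trans (b := (0 : ℝ)) ?_ rfl
    simp [r1, r2, r3, r4, s1, s2, s3, s4]
    linarith
  · refine Eq.trans (b := (0 : ℝ)) ?_ rfl
    simp [r1, r2, r3, r4, s1, s2, s3, s4]
    linarith
  · refine Eq.trans (b := (0 : ℝ)) ?_ rfl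
    simp [r1, r2, r3, r4, s1, s2, s3, s4]
    linarith

theorem GG_Dbar (k : ℕ) (Q : Polynomial ℝ) (c : ℂ) (m : ℕ) {x : E3}
    {a00 a01 a02 a11 a12 a22 : ℝ} (h0 : Grad (V0 k Q c m) a00 a01 a02 x)
    (h1 : Grad (V1 k Q c m) a01 a11 a12 x) (h2 : Grad (V2 k Q c m) a02 a12 a22 x)
    (hs : a00 + a11 + a22 = 0) : Dbar (GG (-1) k Q c m) x = 0 := by
  obtain ⟨-, e0, e1, e2⟩ := GG_fderiv (-1) k Q c m h0 h1 h2
  apply Dbar_zero <;> rw [e0, e1, e2] <;> dsimp only <;> linarith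

theorem Dop_zero (g : E3 → H) (x : E3)
    (h0 : (pd 0 g x).re + (pd 1 g x).imI + (pd 2 g x).imJ = 0)
    (h1 : (pd 0 g x).imI - (pd 1 g x).re - (pd 2 g x).imK = 0)
    (h2 : (pd 0 g x).imJ + (pd 1 g x).imK - (pd 2 g x).re = 0)
    (h3 : (pd 0 g x).imK - (pd 1 g x).imJ + (pd 2 g x).imI = 0) : Dop g x = 0 := by
  have r1 : qe1.re = 0 := rfl
  have r2 : qe1.imI = 1 := rfl
  have r3 : qe1.imJ = 0 := rfl
  have r4 : qe1.imK = 0 := rfl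
  have s1 : qe2.re = 0 := rfl
  have s2 : qe2.imI = 0 := rfl
  have s3 : qe2.imJ = 1 := rfl
  have s4 : qe2.imK = 0 := rfl
  rw [Dop]
  generalize pd 0 g x = p at *
  generalize pd 1 g x = q at *
  generalize pd 2 g x = r at *
  refine Quaternion.ext (R := ℝ) _ _ ?_ ?_ ?_ ?_
  · refine Eq.trans (b := (0 : ℝ)) ?_ rfl
    simp [r1, r2, r3, r4, s1, s2, s3, s4]
    linarith
  · refine Eq.trans (b := (0 : ℝ)) ?_ rfl
    simp [r1, r2, r3, r4, s1, s2, s3, s4]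
    linarith
  · refine Eq.trans (b := (0 : ℝ)) ?_ rfl
    simp [r1, r2, r3, r4, s1, s2, s3, s4]
    linarith
  · refine Eq.trans (b := (0 : ℝ)) ?_ rfl
    simp [r1, r2, r3, r4, s1, s2, s3, s4]
    linarith

theorem GG_Dop (k : ℕ) (Q : Polynomial ℝ) (c : ℂ) (m : ℕ) {x : E3}
    {a00 a01 a02 a11 a12 a22 : ℝ} (h0 : Grad (V0 k Q c m) a00 a01 a02 x)
    (h1 : Grad (V1 k Q c m) a01 a11 a12 x) (h2 : Grad (V2 k Q c m) a02 a12 a22 x)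
    (hs : a00 + a11 + a22 = 0) : Dop (GG 1 k Q c m) x = 0 := by
  obtain ⟨-, e0, e1, e2⟩ := GG_fderiv 1 k Q c m h0 h1 h2
  apply Dop_zero <;> rw [e0, e1, e2] <;> dsimp only <;> linarith

theorem extB_open : IsOpen extB := isOpen_lt continuous_const continuous_norm

theorem sq_norm_H (q : H) : ‖q‖ ^ 2 = q.re ^ 2 + q.imI ^ 2 + q.imJ ^ 2 + q.imK ^ 2 := by
  rw [sq, ← Quaternion.normSq_eq_norm_mul_self q, Quaternion.normSq_def']

theorem GG_L2 (ε : ℝ) (k : ℕ) (Q : Polynomial ℝ) (c : ℂ) (m : ℕ) (h : m + 1 ≤ k)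
    (hd : DifferentiableOn ℝ (GG ε k Q c m) extB) :
    IntegrableOn (fun x => ‖GG ε k Q c m x‖ ^ 2) extB volume := by
  obtain ⟨C0, p0, b0⟩ := bd_V0 k Q c m h
  obtain ⟨C1, p1, b1⟩ := bd_V1 k Q c m h
  obtain ⟨C2, p2, b2⟩ := bd_V2 k Q c m h
  have hI : Integrable (fun x : E3 => (1 + ‖x‖) ^ (-(4 : ℝ))) volume :=
    integrable_one_add_norm (by simp; norm_num)
  refine Integrable.mono' ((hI.const_mul (16 * (C0 ^ 2 + ε ^ 2 * C1 ^ 2 + ε ^ 2 * C2 ^ 2))).integrableOn)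
    ((hd.continuousOn.norm.pow 2).aestronglyMeasurable extB_open.measurableSet) ?_
  refine (ae_restrict_iff' extB_open.measurableSet).mpr (Filter.Eventually.of_forall ?_)
  intro x hx
  have hx' : 1 < sphRho x := by rw [sphRho_eq]; exact hx
  have h0 : 0 < sphRho x := by linarith
  rw [Real.norm_of_nonneg (by positivity), sq_norm_H, GG_re, GG_imI, GG_imJ, GG_imK, ← sphRho_eq]
  have c0 := sq_le_sq' (neg_le_of_abs_le (b0 x hx')) (le_of_abs_le (b0 x hx'))
  have c1 := sq_le_sq' (neg_le_of_abs_le (b1 x hx')) (le_of_abs_le (b1 x hx'))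
  have c2 := sq_le_sq' (neg_le_of_abs_le (b2 x hx')) (le_of_abs_le (b2 x hx'))
  have key : (sphRho x ^ (-2 : ℤ)) ^ 2 ≤ 16 * (1 + sphRho x) ^ (-(4 : ℝ)) := by
    rw [Real.rpow_neg (by positivity), show (4 : ℝ) = ((4 : ℕ) : ℝ) by norm_num, Real.rpow_natCast,
      zpow_neg, inv_pow, ← div_eq_mul_inv, inv_eq_one_div, div_le_div_iff₀ (by positivity) (by positivity)]
    have : (1 + sphRho x) ^ 4 ≤ (2 * sphRho x) ^ 4 := by gcongr; linarith
    have e : (sphRho x ^ (2 : ℤ)) ^ 2 = sphRho x ^ 4 := by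
      rw [zpow_ofNat]; ring
    rw [e]
    linarith [mul_pow 2 (sphRho x) 4]
  rw [mul_pow] at c0 c1 c2
  calc _ = V0 k Q c m x ^ 2 + ε ^ 2 * V1 k Q c m x ^ 2 + ε ^ 2 * V2 k Q c m x ^ 2 := by ring
    _ ≤ C0 ^ 2 * (sphRho x ^ (-2 : ℤ)) ^ 2 + ε ^ 2 * (C1 ^ 2 * (sphRho x ^ (-2 : ℤ)) ^ 2)
        + ε ^ 2 * (C2 ^ 2 * (sphRho x ^ (-2 : ℤ)) ^ 2) := by gcongr
    _ = (C0 ^ 2 + ε ^ 2 * C1 ^ 2 + ε ^ 2 * C2 ^ 2) * (sphRho x ^ (-2 : ℤ)) ^ 2 := by ring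
    _ ≤ (C0 ^ 2 + ε ^ 2 * C1 ^ 2 + ε ^ 2 * C2 ^ 2) * (16 * (1 + sphRho x) ^ (-(4 : ℝ))) := by gcongr
    _ = _ := by ring

theorem qip_integrable (f g : E3 → H) (hf : ContinuousOn f extB) (hg : ContinuousOn g extB)
    (hf2 : IntegrableOn (fun x => ‖f x‖ ^ 2) extB volume)
    (hg2 : IntegrableOn (fun x => ‖g x‖ ^ 2) extB volume) :
    IntegrableOn (fun x => qip (f x) (g x)) extB volume := by
  have cont : ContinuousOn (fun x => qip (f x) (g x)) extB := by
    unfold qip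
    exact (((Quaternion.continuous_re.comp_continuousOn hf).mul
      (Quaternion.continuous_re.comp_continuousOn hg)).add
      ((Quaternion.continuous_imI.comp_continuousOn hf).mul
      (Quaternion.continuous_imI.comp_continuousOn hg))).add
      ((Quaternion.continuous_imJ.comp_continuousOn hf).mul
      (Quaternion.continuous_imJ.comp_continuousOn hg))
  refine Integrable.mono' (Integrable.add hf2 hg2)
    (cont.aestronglyMeasurable extB_open.measurableSet) (Filter.Eventually.of_forall fun x => ?_)
  simp only [Pi.add_apply, sq_norm_H, qip, Real.norm_eq_abs]
  generalize f x = p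
  generalize g x = q
  rw [abs_le]
  constructor <;>
  nlinarith [sq_nonneg (p.re - q.re), sq_nonneg (p.re + q.re), sq_nonneg (p.imI - q.imI),
    sq_nonneg (p.imI + q.imI), sq_nonneg (p.imJ - q.imJ), sq_nonneg (p.imJ + q.imJ),
    sq_nonneg p.imK, sq_nonneg q.imK, sq_nonneg p.re, sq_nonneg q.re, sq_nonneg p.imI,
    sq_nonneg q.imI, sq_nonneg p.imJ, sq_nonneg q.imJ]

/-- if `f` is a square-integrable contragenic function on
`B^e = {|x| > 1}` (harmonic, `𝒜`-valued, orthogonal to all monogenic and all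
antimonogenic `L²` functions), then `Sc f` is `L²`-orthogonal to every
`U_{n,m}^{±}` with `n ≤ -2`, `0 ≤ m ≤ -n-2`. -/
theorem stmt17 (f : E3 → H) (hA : ∀ x, (f x).imK = 0)
    (hsm : ContDiffOn ℝ 2 f extB)
    (hharm : ∀ x ∈ extB,
      (∑ i : Fin 3, fderiv ℝ (fun y => fderiv ℝ f y (EuclideanSpace.single i 1)) x
        (EuclideanSpace.single i 1)) = 0)
    (hL2 : IntegrableOn (fun x => ‖f x‖ ^ 2) extB volume)
    (horth : ∀ g : E3 → H, (∀ x, (g x).imK = 0) → DifferentiableOn ℝ g extB →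
      IntegrableOn (fun x => ‖g x‖ ^ 2) extB volume →
      ((∀ x ∈ extB, Dbar g x = 0) ∨ (∀ x ∈ extB, Dop g x = 0)) →
      ∫ x in extB, qip (f x) (g x) = 0) :
    ∀ (n : ℤ) (m : ℕ) (sgn : Bool), n ≤ -2 → (m : ℤ) ≤ -n - 2 →
      ∫ x in extB, (f x).re * solidU n m sgn x = 0 := by
  intro n m sgn hn hm
  obtain ⟨M, hM⟩ : ∃ M : ℕ, n = -(((M + 1 : ℕ) : ℤ) + 1) := ⟨(-n - 2).toNat, by omega⟩
  have hmM : m ≤ M := by omega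
  subst hM
  set k := M + 1 + m with hk
  set Q := (Polynomial.derivative)^[m] (LP M) with hQdef
  set c := cc sgn
  have hpos : ∀ x ∈ extB, 0 < sphRho x := fun x hx => by
    rw [sphRho_eq]; exact zero_lt_one.trans hx
  have hQ : ∀ t, (1 - t ^ 2) * (Polynomial.derivative (Polynomial.derivative Q)).eval t
      - 2 * (m + 1) * t * (Polynomial.derivative Q).eval t
      + (k : ℝ) * (k - 1 - 2 * m) * Q.eval t = 0 := by
    intro t
    have h := congrArg (Polynomial.eval t) (LP_C_iter M m)
    rw [Function.iterate_succ_apply', Function.iterate_succ_apply', ← hQdef] at h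
    simp only [Polynomial.eval_sub, Polynomial.eval_add, Polynomial.eval_mul, Polynomial.eval_pow,
        Polynomial.eval_C, Polynomial.eval_X, Polynomial.eval_one, Polynomial.eval_zero,
        Polynomial.eval_ofNat] at h
    rw [hk]
    push_cast
    linear_combination h
  have hdiff : ∀ ε, DifferentiableOn ℝ (GG ε k Q c m) extB := fun ε x hx => by
    obtain ⟨_, _, _, _, _, _, h0, h1, h2, -⟩ := V_grads (hpos x hx) k Q c m hQ
    exact (GG_fderiv ε k Q c m h0 h1 h2).1.differentiableWithinAt
  have hL : ∀ ε, IntegrableOn (fun x => ‖GG ε k Q c m x‖ ^ 2) extB volume := fun ε =>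
    GG_L2 ε k Q c m (by omega) (hdiff ε)
  have i1 := horth (GG (-1) k Q c m) (GG_imK _ _ _ _ _) (hdiff _) (hL _) (Or.inl fun x hx => by
    obtain ⟨_, _, _, _, _, _, h0, h1, h2, hs⟩ := V_grads (hpos x hx) k Q c m hQ
    exact GG_Dbar k Q c m h0 h1 h2 hs)
  have i2 := horth (GG 1 k Q c m) (GG_imK _ _ _ _ _) (hdiff _) (hL _) (Or.inr fun x hx => by
    obtain ⟨_, _, _, _, _, _, h0, h1, h2, hs⟩ := V_grads (hpos x hx) k Q c m hQ
    exact GG_Dop k Q c m h0 h1 h2 hs)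
  have j : ∀ ε, IntegrableOn (fun x => qip (f x) (GG ε k Q c m x)) extB volume := fun ε =>
    qip_integrable f _ hsm.continuousOn (hdiff ε).continuousOn hL2 (hL ε)
  have hadd := integral_add (j (-1)) (j 1)
  rw [i1, i2, add_zero] at hadd
  have hne : -((M : ℝ) + 1 - m) ≠ 0 := by
    have : (m : ℝ) ≤ M := by exact_mod_cast hmM
    intro h
    linarith
  have hcong : ∫ x in extB, (f x).re * solidU (-(((M + 1 : ℕ) : ℤ) + 1)) m sgn x =
      ∫ x in extB, (2 * -((M : ℝ) + 1 - m))⁻¹ *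
        (qip (f x) (GG (-1) k Q c m x) + qip (f x) (GG 1 k Q c m x)) := by
    refine setIntegral_congr_fun extB_open.measurableSet fun x hx => ?_
    have e := V0_eq M m c x
    have e' := solidU_eq (M + 1) m sgn (hpos x hx)
    simp only [qip, GG_re, GG_imI, GG_imJ]
    rw [← e'] at e
    have e2 : (2 * -((M : ℝ) + 1 - m))⁻¹ * (2 * -((M : ℝ) + 1 - m)) = 1 :=
      inv_mul_cancel₀ (mul_ne_zero two_ne_zero hne)
    rw [e]
    linear_combination (-(f x).re * solidU (-(((M + 1 : ℕ) : ℤ) + 1)) m sgn x) * e2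
  rw [hcong, integral_const_mul, hadd, mul_zero]

end
end
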